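/- arXiv:2311.15347 — 5 statements merged into one kernel-verified Lean document; each statement's English description precedes it below -/
import Mathlib

section
/- Define H : ℓ^∞(M₁) → ℓ^∞(M₂) by H(φ)(m₂) = inf_{m₁ ∈ M₁} ( h(m₁)(m₂) + ‖φ − Ψ₁(m₁)‖_∞ ). Then: (i) for every φ ∈ ℓ^∞(M₁) and m₂ ∈ M₂ the infimum is finite, and the function m₂ ↦ H(φ)(m₂) is bounded, so H(φ) ∈ ℓ^∞(M₂); (ii) H is 1-Lipschitz, i.e. ‖H(φ) − H(ψ)‖_∞ ≤ ‖φ − ψ‖_∞ for all φ, ψ ∈ ℓ^∞(M₁); (iii) H extends h, i.e. H(Ψ₁(m)) = h(m) for every m ∈ M₁. -/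
theorem bddAbove_range_abs_sub {α : Type*} {f g : α → ℝ} {C D : ℝ}
    (hf : ∀ a, |f a| ≤ C) (hg : ∀ a, |g a| ≤ D) :
    BddAbove (Set.range fun a => |f a - g a|) := by
  refine ⟨C + D, ?_⟩
  rintro _ ⟨a, rfl⟩
  exact (abs_sub (f a) (g a)).trans (add_le_add (hf a) (hg a))


/-- **Extension of a 1-Lipschitz map along the Kuratowski embedding.**
Let `(M₁, d₁)` and `(M₂, d₂)` be nonempty metric spaces, `ℓ^∞(Mᵢ)` modeled as
bounded real-valued functions with sup norm (expressed via suprema), `Ψ₁` the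
Kuratowski embedding of `M₁` with basepoint `x₀`, and `h : M₁ → ℓ^∞(M₂)` a
1-Lipschitz map. Define `H(φ)(m₂) = inf_{m₁} (h(m₁)(m₂) + ‖φ - Ψ₁(m₁)‖_∞)`.
Then: (i) for every bounded `φ` the infimum is finite (the infimized family is
bounded below) and `H(φ)` is bounded, so `H(φ) ∈ ℓ^∞(M₂)`; (ii) `H` is
1-Lipschitz for the sup norms; (iii) `H` extends `h`: `H(Ψ₁ m) = h m`. -/
theorem lipschitz_extension_of_kuratowski
    {M₁ M₂ : Type*} [MetricSpace M₁] [MetricSpace M₂] [Nonempty M₁] [Nonempty M₂]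
    (x₀ : M₁) (Ψ₁ : M₁ → M₁ → ℝ) (hΨ₁ : ∀ x y, Ψ₁ x y = dist x y - dist x₀ y)
    (h : M₁ → M₂ → ℝ)
    (hbdd : ∀ m : M₁, ∃ C : ℝ, ∀ m₂ : M₂, |h m m₂| ≤ C)
    (hlip : ∀ m m' : M₁, (⨆ m₂ : M₂, |h m m₂ - h m' m₂|) ≤ dist m m')
    (H : (M₁ → ℝ) → (M₂ → ℝ))
    (hH : ∀ φ : M₁ → ℝ, ∀ m₂ : M₂,
      H φ m₂ = ⨅ m₁ : M₁, (h m₁ m₂ + ⨆ y : M₁, |φ y - Ψ₁ m₁ y|)) :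
    -- (i) finiteness of the infimum and boundedness of `H φ`
    (∀ φ : M₁ → ℝ, (∃ C : ℝ, ∀ y : M₁, |φ y| ≤ C) →
      (∀ m₂ : M₂,
        BddBelow (Set.range fun m₁ : M₁ => h m₁ m₂ + ⨆ y : M₁, |φ y - Ψ₁ m₁ y|)) ∧
      (∃ C : ℝ, ∀ m₂ : M₂, |H φ m₂| ≤ C)) ∧
    -- (ii) `H` is 1-Lipschitz for the sup norms
    (∀ φ ψ : M₁ → ℝ, (∃ C : ℝ, ∀ y : M₁, |φ y| ≤ C) → (∃ C : ℝ, ∀ y : M₁, |ψ y| ≤ C) →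
      (⨆ m₂ : M₂, |H φ m₂ - H ψ m₂|) ≤ ⨆ y : M₁, |φ y - ψ y|) ∧
    -- (iii) `H` extends `h`
    (∀ m : M₁, H (Ψ₁ m) = h m) := by
  have h_apply : ∀ m m' m₂, h m m₂ ≤ h m' m₂ + dist m m' := by
    intro m m' m₂
    obtain ⟨C, hC⟩ := hbdd m
    obtain ⟨C', hC'⟩ := hbdd m'
    have hle := (le_ciSup (bddAbove_range_abs_sub hC hC') m₂).trans (hlip m m')
    linarith [le_abs_self (h m m₂ - h m' m₂)]
  have hΨ_bdd : ∀ m y, |Ψ₁ m y| ≤ dist m x₀ := fun m y => by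
    rw [hΨ₁]
    exact abs_dist_sub_le m x₀ y
  have h_le : ∀ φ : M₁ → ℝ, (∃ C : ℝ, ∀ y, |φ y| ≤ C) → ∀ m y,
      |φ y - Ψ₁ m y| ≤ ⨆ y, |φ y - Ψ₁ m y| := by
    rintro φ ⟨C, hC⟩ m y
    exact le_ciSup (bddAbove_range_abs_sub hC (hΨ_bdd m)) y
  have h_lower : ∀ φ : M₁ → ℝ, (∃ C : ℝ, ∀ y, |φ y| ≤ C) → ∀ m₁ m₂,
      h x₀ m₂ - |φ x₀| ≤ h m₁ m₂ + ⨆ y, |φ y - Ψ₁ m₁ y| := by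
    intro φ hφ m₁ m₂
    have hsup := h_le φ hφ m₁ x₀
    rw [hΨ₁, dist_self, sub_zero] at hsup
    linarith [h_apply x₀ m₁ m₂, dist_comm x₀ m₁, neg_abs_le (φ x₀ - dist m₁ x₀),
      le_abs_self (φ x₀)]
  have h_bddBelow : ∀ φ : M₁ → ℝ, (∃ C : ℝ, ∀ y, |φ y| ≤ C) → ∀ m₂,
      BddBelow (Set.range fun m₁ => h m₁ m₂ + ⨆ y, |φ y - Ψ₁ m₁ y|) := by
    intro φ hφ m₂
    refine ⟨h x₀ m₂ - |φ x₀|, ?_⟩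
    rintro _ ⟨m₁, rfl⟩
    exact h_lower φ hφ m₁ m₂
  have h_sub_le : ∀ φ ψ : M₁ → ℝ, (∃ C : ℝ, ∀ y, |φ y| ≤ C) → (∃ C : ℝ, ∀ y, |ψ y| ≤ C) →
      ∀ m₂, H φ m₂ ≤ H ψ m₂ + ⨆ y, |φ y - ψ y| := by
    intro φ ψ hφ hψ m₂
    obtain ⟨C, hC⟩ := hφ
    obtain ⟨D, hD⟩ := hψ
    rw [hH, hH, ← sub_le_iff_le_add]
    refine le_ciInf fun m₁ => ?_
    have hinf := ciInf_le (h_bddBelow φ ⟨C, hC⟩ m₂) m₁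
    have hsup : ⨆ y, |φ y - Ψ₁ m₁ y| ≤ (⨆ y, |φ y - ψ y|) + ⨆ y, |ψ y - Ψ₁ m₁ y| :=
      ciSup_le fun y => (abs_sub_le _ (ψ y) _).trans
        (add_le_add (le_ciSup (bddAbove_range_abs_sub hC hD) y) (h_le ψ ⟨D, hD⟩ m₁ y))
    linarith
  refine ⟨fun φ hφ => ⟨h_bddBelow φ hφ, ?_⟩, fun φ ψ hφ hψ => ciSup_le fun m₂ => ?_,
    fun m => funext fun m₂ => ?_⟩
  · obtain ⟨C, hC⟩ := hφ
    obtain ⟨D, hD⟩ := hbdd x₀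
    refine ⟨D + C, fun m₂ => abs_le.2 ⟨?_, ?_⟩⟩
    · rw [hH]
      refine le_ciInf fun m₁ => ?_
      linarith [h_lower φ ⟨C, hC⟩ m₁ m₂, hC x₀, (abs_le.1 (hD m₂)).1]
    · rw [hH]
      refine (ciInf_le (h_bddBelow φ ⟨C, hC⟩ m₂) x₀).trans
        (add_le_add ((le_abs_self _).trans (hD m₂)) (ciSup_le fun y => ?_))
      simpa [hΨ₁] using hC y
  · have hle := h_sub_le φ ψ hφ hψ m₂
    have hge := h_sub_le ψ φ hψ hφ m₂
    simp only [abs_sub_comm (ψ _) (φ _)] at hge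
    exact abs_sub_le_iff.2 ⟨by linarith, by linarith⟩
  · have hb : ∃ C : ℝ, ∀ y, |Ψ₁ m y| ≤ C := ⟨_, hΨ_bdd m⟩
    rw [hH]
    refine le_antisymm ((ciInf_le (h_bddBelow _ hb m₂) m).trans_eq (by simp))
      (le_ciInf fun m₁ => ?_)
    have hsup := h_le _ hb m₁ m₁
    rw [hΨ₁, hΨ₁, dist_self] at hsup
    linarith [h_apply m m₁ m₂, le_abs_self (dist m m₁ - dist x₀ m₁ - (0 - dist x₀ m₁))]
end

section
/- With H : ℓ^∞(M₁) → ℓ^∞(M₂) defined by H(φ)(m₂) = inf_{m₁ ∈ M₁} ( h(m₁)(m₂) + ‖φ − Ψ₁(m₁)‖_∞ ), the following holds: for every R ≥ 0 and every φ ∈ ℓ^∞(M₁) with inf_{m ∈ M₁} ‖φ − Ψ₁(m)‖_∞ ≤ R, one has inf_{m ∈ M₁} ‖H(φ) − h(m)‖_∞ ≤ R. In other words, H maps the closed R-neighborhood of Ψ₁(M₁) in ℓ^∞(M₁) into the closed R-neighborhood of h(M₁) in ℓ^∞(M₂). -/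
/-- **`H` maps `R`-neighborhoods of `Ψ₁(M₁)` into `R`-neighborhoods of `h(M₁)`.**
With `H(φ)(m₂) = inf_{m₁} (h(m₁)(m₂) + ‖φ - Ψ₁(m₁)‖_∞)` as before (where `h` is
1-Lipschitz and `Ψ₁` is the Kuratowski embedding with basepoint `x₀`): for every
`R ≥ 0` and every bounded `φ : M₁ → ℝ` with `inf_{m} ‖φ - Ψ₁(m)‖_∞ ≤ R`, one has
`inf_{m} ‖H(φ) - h(m)‖_∞ ≤ R`. -/
theorem extension_maps_neighborhood_into_neighborhood
    {M₁ M₂ : Type*} [MetricSpace M₁] [MetricSpace M₂] [Nonempty M₁] [Nonempty M₂]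
    (x₀ : M₁) (Ψ₁ : M₁ → M₁ → ℝ) (hΨ₁ : ∀ x y, Ψ₁ x y = dist x y - dist x₀ y)
    (h : M₁ → M₂ → ℝ)
    (hbdd : ∀ m : M₁, ∃ C : ℝ, ∀ m₂ : M₂, |h m m₂| ≤ C)
    (hlip : ∀ m m' : M₁, (⨆ m₂ : M₂, |h m m₂ - h m' m₂|) ≤ dist m m')
    (H : (M₁ → ℝ) → (M₂ → ℝ))
    (hH : ∀ φ : M₁ → ℝ, ∀ m₂ : M₂,
      H φ m₂ = ⨅ m₁ : M₁, (h m₁ m₂ + ⨆ y : M₁, |φ y - Ψ₁ m₁ y|))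
    (R : ℝ) (hR : 0 ≤ R)
    (φ : M₁ → ℝ) (hφ : ∃ C : ℝ, ∀ y : M₁, |φ y| ≤ C)
    (hnear : (⨅ m : M₁, ⨆ y : M₁, |φ y - Ψ₁ m y|) ≤ R) :
    (⨅ m : M₁, ⨆ m₂ : M₂, |H φ m₂ - h m m₂|) ≤ R := by
  have hφΨ : ∀ m y : M₁, |φ y - Ψ₁ m y| ≤ ⨆ y : M₁, |φ y - Ψ₁ m y| := by
    intro m
    obtain ⟨C, hC⟩ := hφ
    refine le_ciSup (f := fun y => |φ y - Ψ₁ m y|) ⟨C + dist m x₀, ?_⟩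
    rintro _ ⟨y, rfl⟩
    have hΨ : |Ψ₁ m y| ≤ dist m x₀ := hΨ₁ m y ▸ abs_dist_sub_le m x₀ y
    exact (abs_sub _ _).trans (add_le_add (hC y) hΨ)
  have hdist : ∀ m m' : M₁,
      dist m m' ≤ (⨆ y : M₁, |φ y - Ψ₁ m y|) + ⨆ y : M₁, |φ y - Ψ₁ m' y| := by
    intro m m'
    have h₁ := neg_le_of_abs_le (hφΨ m m')
    have h₂ := le_of_abs_le (hφΨ m' m')
    rw [hΨ₁] at h₁ h₂
    rw [dist_self] at h₂
    linarith
  have hh : ∀ (m m' : M₁) (m₂ : M₂), |h m m₂ - h m' m₂| ≤ dist m m' := by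
    intro m m' m₂
    obtain ⟨C, hC⟩ := hbdd m
    obtain ⟨C', hC'⟩ := hbdd m'
    refine (le_ciSup (f := fun m₂ => |h m m₂ - h m' m₂|) ⟨C + C', ?_⟩ m₂).trans (hlip m m')
    rintro _ ⟨z, rfl⟩
    exact (abs_sub _ _).trans (add_le_add (hC z) (hC' z))
  have hlower : ∀ (m m₁ : M₁) (m₂ : M₂), h m m₂ - (⨆ y : M₁, |φ y - Ψ₁ m y|) ≤
      h m₁ m₂ + ⨆ y : M₁, |φ y - Ψ₁ m₁ y| := by
    intro m m₁ m₂
    linarith [hdist m m₁, le_of_abs_le (hh m m₁ m₂)]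
  refine (ciInf_mono ⟨0, ?_⟩ fun m => ciSup_le fun m₂ => ?_).trans hnear
  · rintro _ ⟨m, rfl⟩
    exact Real.iSup_nonneg fun m₂ => abs_nonneg _
  · have hle : H φ m₂ ≤ h m m₂ + ⨆ y : M₁, |φ y - Ψ₁ m y| := by
      rw [hH]
      refine ciInf_le (f := fun m₁ => h m₁ m₂ + ⨆ y : M₁, |φ y - Ψ₁ m₁ y|)
        ⟨h m m₂ - ⨆ y : M₁, |φ y - Ψ₁ m y|, ?_⟩ m
      rintro _ ⟨m₁, rfl⟩
      exact hlower m m₁ m₂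
    have hge : h m m₂ - (⨆ y : M₁, |φ y - Ψ₁ m y|) ≤ H φ m₂ := by
      rw [hH]
      exact le_ciInf fun m₁ => hlower m m₁ m₂
    rw [abs_le]
    constructor <;> linarith
end

section
/- Let I be a two-sided ideal of A and suppose α − β ∈ I. Then the matrix d(α,β) := Z(β)⁻¹ · diag(α, 1−β, 0, 0) · Z(β) is an idempotent in M₄(A), and d(α,β) − diag(1,0,0,0) has all its entries in I, i.e. d(α,β) − e₁,₃ ∈ M₄(I), where e₁,₃ = diag(1,0,0,0). -/
/-- **The difference construction yields an idempotent congruent to `e₁,₃` mod `I`.**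
Let `A` be a unital ring, `α, β ∈ A` idempotents, and `I` a two-sided ideal of `A`
with `α - β ∈ I`. Then `d(α, β) = Z(β)⁻¹ · diag(α, 1 - β, 0, 0) · Z(β)` is an
idempotent in `M₄(A)`, and all entries of `d(α, β) - e₁,₃` lie in `I`, where
`e₁,₃ = diag(1, 0, 0, 0)`. -/
theorem difference_construction_idempotent_mod_ideal
    {A : Type*} [Ring A] (α β : A) (hα : α ^ 2 = α) (hβ : β ^ 2 = β)
    (I : TwoSidedIdeal A) (hαβ : α - β ∈ I)
    (Z Zinv D e₁₃ : Matrix (Fin 4) (Fin 4) A)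
    (hZ : Z = !![β, 0, 1 - β, 0;
                 1 - β, 0, 0, β;
                 0, 0, β, 1 - β;
                 0, 1, 0, 0])
    (hZinv : Zinv = !![β, 1 - β, 0, 0;
                       0, 0, 0, 1;
                       1 - β, 0, β, 0;
                       0, β, 1 - β, 0])
    (hD : D = !![α, 0, 0, 0;
                 0, 1 - β, 0, 0;
                 0, 0, 0, 0;
                 0, 0, 0, 0])
    (he : e₁₃ = !![1, 0, 0, 0;
                   0, 0, 0, 0;
                   0, 0, 0, 0;
                   0, 0, 0, 0]) :
    (Zinv * D * Z) * (Zinv * D * Z) = Zinv * D * Z ∧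
    ∀ i j : Fin 4, (Zinv * D * Z - e₁₃) i j ∈ I := by
  have hα' : α * α = α := by rw [← sq, hα]
  have hβ' : β * β = β := by rw [← sq, hβ]
  have hZZ : Z * Zinv = 1 := by
    subst hZ hZinv
    ext i j
    fin_cases i <;> fin_cases j <;>
      simp [Matrix.mul_apply, Fin.sum_univ_four, mul_sub, sub_mul, hβ']
  have hDD : D * D = D := by
    subst hD
    ext i j
    fin_cases i <;> fin_cases j <;>
      simp [Matrix.mul_apply, Fin.sum_univ_four, mul_sub, sub_mul, hα', hβ']
  have hd : Zinv * D * Z - e₁₃ =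
      !![β * (α - β) * β, 0, β * (α - β) * (1 - β), 0;
         0, 0, 0, 0;
         (1 - β) * (α - β) * β, 0, (1 - β) * (α - β) * (1 - β), 0;
         0, 0, 0, 0] := by
    subst hZ hZinv hD he
    ext i j
    fin_cases i <;> fin_cases j <;>
      simp [mul_sub, sub_mul, hβ']
    abel
  refine ⟨?_, fun i j => ?_⟩
  · calc Zinv * D * Z * (Zinv * D * Z) = Zinv * D * (Z * Zinv) * D * Z := by
          simp only [Matrix.mul_assoc]
      _ = Zinv * D * Z := by rw [hZZ, Matrix.mul_one, Matrix.mul_assoc Zinv, hDD]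
  · have hmem (x y : A) : x * (α - β) * y ∈ I :=
      I.mul_mem_right _ _ (I.mul_mem_left _ _ hαβ)
    rw [hd]
    fin_cases i <;> fin_cases j <;> first | exact hmem _ _ | exact I.zero_mem
end

section
/- The function χ : ℝ → ℝ defined by χ(x) = (2/π) ∫₀^x (1 − cos y)/y² dy is a normalizing function: (i) χ is odd, i.e. χ(−x) = −χ(x) for all x; (ii) χ is monotone nondecreasing; (iii) lim_{x→+∞} χ(x) = 1 and lim_{x→−∞} χ(x) = −1; equivalently, the improper integral ∫₀^∞ (1 − cos y)/y² dy equals π/2. -/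
open MeasureTheory

/-- The improper fundamental theorem of calculus for a nonnegative derivative, as a lower
Lebesgue integral. -/
theorem lintegral_Ioi_of_hasDerivAt_of_nonneg {g g' : ℝ → ℝ} {a l : ℝ}
    (hderiv : ∀ x ∈ Set.Ici a, HasDerivAt g (g' x) x) (hpos : ∀ x ∈ Set.Ioi a, 0 ≤ g' x)
    (hg : Filter.Tendsto g Filter.atTop (nhds l)) :
    ∫⁻ x in Set.Ioi a, ENNReal.ofReal (g' x) = ENNReal.ofReal (l - g a) := by
  rw [← integral_Ioi_of_hasDerivAt_of_nonneg' hderiv hpos hg,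
    ofReal_integral_eq_lintegral_ofReal (integrableOn_Ioi_deriv_of_nonneg' hderiv hpos hg)]
  exact (ae_restrict_iff' measurableSet_Ioi).2 (.of_forall hpos)

theorem tendsto_exp_neg_mul_atTop {x : ℝ} (hx : 0 < x) :
    Filter.Tendsto (fun y : ℝ => Real.exp (-(x * y))) Filter.atTop (nhds 0) :=
  Real.tendsto_exp_neg_atTop_nhds_zero.comp (Filter.tendsto_id.const_mul_atTop hx)

theorem hasDerivAt_exp_neg_mul (x y : ℝ) :
    HasDerivAt (fun t : ℝ => Real.exp (-(x * t))) (-x * Real.exp (-(x * y))) y := by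
  refine ((hasDerivAt_id y).const_mul x).neg.exp.congr_deriv ?_
  simp only [Pi.neg_apply, id]
  ring

theorem lintegral_one_sub_cos_mul_exp_left {y : ℝ} (hy : 0 < y) :
    ∫⁻ x in Set.Ioi (0 : ℝ), ENNReal.ofReal ((1 - Real.cos y) * (x * Real.exp (-(y * x)))) =
      ENNReal.ofReal ((1 - Real.cos y) / y ^ 2) := by
  have hc : 0 ≤ 1 - Real.cos y := sub_nonneg.2 (Real.cos_le_one y)
  rw [lintegral_Ioi_of_hasDerivAt_of_nonneg (l := 0) (g := fun x =>
    -(1 - Real.cos y) * ((x / y + 1 / y ^ 2) * Real.exp (-(y * x))))]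
  · congr 1
    simp
    ring
  · intro x _
    refine (((((hasDerivAt_id x).div_const y).add_const (1 / y ^ 2)).mul
      (hasDerivAt_exp_neg_mul y x)).const_mul _).congr_deriv ?_
    simp only [id]
    field_simp
    ring
  · intro x hx
    have : 0 < x := hx
    positivity
  · have h1 : Filter.Tendsto (fun x : ℝ => x * Real.exp (-(y * x))) Filter.atTop (nhds 0) := by
      simpa using tendsto_rpow_mul_exp_neg_mul_atTop_nhds_zero 1 y hy
    have h := ((h1.div_const y).add ((tendsto_exp_neg_mul_atTop hy).const_mul (1 / y ^ 2))).const_mul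
      (-(1 - Real.cos y))
    convert h using 2 <;> ring

theorem lintegral_one_sub_cos_mul_exp_right {x : ℝ} (hx : 0 < x) :
    ∫⁻ y in Set.Ioi (0 : ℝ), ENNReal.ofReal ((1 - Real.cos y) * (x * Real.exp (-(y * x)))) =
      ENNReal.ofReal (1 / (1 + x ^ 2)) := by
  have hx2 : 1 + x ^ 2 ≠ 0 := by positivity
  rw [lintegral_Ioi_of_hasDerivAt_of_nonneg (l := 0) (g := fun y =>
    Real.exp (-(x * y)) * (-1 - x / (1 + x ^ 2) * (Real.sin y - x * Real.cos y)))]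
  · congr 1
    simp
    field_simp
    ring
  · intro y _
    refine ((hasDerivAt_exp_neg_mul x y).mul ((((Real.hasDerivAt_sin y).sub
      ((Real.hasDerivAt_cos y).const_mul x)).const_mul (x / (1 + x ^ 2))).const_sub
        (-1))).congr_deriv ?_
    rw [mul_comm y x, Pi.sub_apply]
    field_simp
    ring
  · intro y _
    have hc : 0 ≤ 1 - Real.cos y := sub_nonneg.2 (Real.cos_le_one y)
    positivity
  · refine (tendsto_exp_neg_mul_atTop hx).zero_mul_isBoundedUnder_le ?_
    refine Filter.isBoundedUnder_of ⟨1 + |x / (1 + x ^ 2)| * (1 + |x|), fun y => ?_⟩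
    have hs := Real.abs_sin_le_one y
    have hc := Real.abs_cos_le_one y
    calc |-1 - x / (1 + x ^ 2) * (Real.sin y - x * Real.cos y)|
        ≤ |-1| + |x / (1 + x ^ 2) * (Real.sin y - x * Real.cos y)| := abs_sub _ _
      _ = 1 + |x / (1 + x ^ 2)| * |Real.sin y - x * Real.cos y| := by rw [abs_mul]; simp
      _ ≤ 1 + |x / (1 + x ^ 2)| * (|Real.sin y| + |x * Real.cos y|) := by
          gcongr; exact abs_sub _ _
      _ ≤ 1 + |x / (1 + x ^ 2)| * (1 + |x|) := by
          rw [abs_mul x]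
          gcongr
          exact mul_le_of_le_one_right (abs_nonneg x) hc

theorem one_sub_cos_div_sq_nonneg (y : ℝ) : 0 ≤ (1 - Real.cos y) / y ^ 2 :=
  div_nonneg (sub_nonneg.2 (Real.cos_le_one y)) (sq_nonneg y)

theorem measurable_one_sub_cos_div_sq : Measurable fun y : ℝ => (1 - Real.cos y) / y ^ 2 := by
  fun_prop

theorem lintegral_Ioi_one_sub_cos_div_sq :
    ∫⁻ y in Set.Ioi (0 : ℝ), ENNReal.ofReal ((1 - Real.cos y) / y ^ 2) =
      ENNReal.ofReal (Real.pi / 2) := by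
  calc _ = ∫⁻ y in Set.Ioi (0 : ℝ), ∫⁻ x in Set.Ioi (0 : ℝ),
          ENNReal.ofReal ((1 - Real.cos y) * (x * Real.exp (-(y * x)))) :=
        setLIntegral_congr_fun measurableSet_Ioi fun y hy =>
          (lintegral_one_sub_cos_mul_exp_left hy).symm
    _ = ∫⁻ x in Set.Ioi (0 : ℝ), ∫⁻ y in Set.Ioi (0 : ℝ),
          ENNReal.ofReal ((1 - Real.cos y) * (x * Real.exp (-(y * x)))) :=
        lintegral_lintegral_swap (by unfold Function.uncurry; fun_prop)
    _ = ∫⁻ x in Set.Ioi (0 : ℝ), ENNReal.ofReal (1 / (1 + x ^ 2)) :=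
        setLIntegral_congr_fun measurableSet_Ioi fun x hx =>
          lintegral_one_sub_cos_mul_exp_right hx
    _ = ENNReal.ofReal (Real.pi / 2 - Real.arctan 0) :=
        lintegral_Ioi_of_hasDerivAt_of_nonneg (fun x _ => Real.hasDerivAt_arctan x)
          (fun x _ => by positivity)
          (Real.tendsto_arctan_atTop.mono_right nhdsWithin_le_nhds)
    _ = ENNReal.ofReal (Real.pi / 2) := by simp

theorem integrableOn_Ioi_one_sub_cos_div_sq :
    IntegrableOn (fun y : ℝ => (1 - Real.cos y) / y ^ 2) (Set.Ioi 0) := by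
  refine ⟨measurable_one_sub_cos_div_sq.aestronglyMeasurable, ?_⟩
  rw [hasFiniteIntegral_iff_ofReal (.of_forall one_sub_cos_div_sq_nonneg),
    lintegral_Ioi_one_sub_cos_div_sq]
  exact ENNReal.ofReal_lt_top

theorem integral_Ioi_one_sub_cos_div_sq :
    ∫ y in Set.Ioi (0 : ℝ), (1 - Real.cos y) / y ^ 2 = Real.pi / 2 := by
  rw [integral_eq_lintegral_of_nonneg_ae (.of_forall one_sub_cos_div_sq_nonneg)
    measurable_one_sub_cos_div_sq.aestronglyMeasurable, lintegral_Ioi_one_sub_cos_div_sq,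
    ENNReal.toReal_ofReal (by positivity)]

theorem intervalIntegrable_one_sub_cos_div_sq (a b : ℝ) :
    IntervalIntegrable (fun y : ℝ => (1 - Real.cos y) / y ^ 2) volume a b := by
  refine (intervalIntegrable_const (c := (1 / 2 : ℝ))).mono_fun
    measurable_one_sub_cos_div_sq.aestronglyMeasurable (.of_forall fun y => ?_)
  dsimp only
  rw [Real.norm_of_nonneg (one_sub_cos_div_sq_nonneg y), Real.norm_of_nonneg (by norm_num)]
  refine div_le_of_le_mul₀ (sq_nonneg y) (by norm_num) ?_
  linarith [Real.one_sub_sq_div_two_le_cos (x := y)]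

/-- **`χ(x) = (2/π) ∫₀ˣ (1 - cos y)/y² dy` is a normalizing function.**
The function `χ` is odd, monotone nondecreasing, tends to `1` at `+∞` and to
`-1` at `-∞`; equivalently, `∫₀^∞ (1 - cos y)/y² dy = π/2`. -/
theorem chi_is_normalizing_function
    (χ : ℝ → ℝ)
    (hχ : ∀ x : ℝ, χ x = (2 / Real.pi) * ∫ y in (0 : ℝ)..x, (1 - Real.cos y) / y ^ 2) :
    (∀ x : ℝ, χ (-x) = -χ x) ∧
    Monotone χ ∧
    Filter.Tendsto χ Filter.atTop (nhds 1) ∧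
    Filter.Tendsto χ Filter.atBot (nhds (-1)) ∧
    (∫ y in Set.Ioi (0 : ℝ), (1 - Real.cos y) / y ^ 2) = Real.pi / 2 := by
  have hodd : ∀ x : ℝ, χ (-x) = -χ x := fun x => by
    have h := intervalIntegral.integral_comp_neg (a := 0) (b := x)
      fun y : ℝ => (1 - Real.cos y) / y ^ 2
    simp only [Real.cos_neg, neg_sq, neg_zero] at h
    rw [hχ, hχ, h, intervalIntegral.integral_symm, mul_neg]
  have htop : Filter.Tendsto χ Filter.atTop (nhds 1) := by
    have h := (intervalIntegral_tendsto_integral_Ioi 0 integrableOn_Ioi_one_sub_cos_div_sq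
      Filter.tendsto_id).const_mul (2 / Real.pi)
    rw [integral_Ioi_one_sub_cos_div_sq, div_mul_div_cancel₀' two_ne_zero,
      div_self Real.pi_ne_zero] at h
    exact h.congr fun x => (hχ x).symm
  refine ⟨hodd, fun a b hab => ?_, htop, ?_, integral_Ioi_one_sub_cos_div_sq⟩
  · have h := intervalIntegral.integral_nonneg (μ := volume) hab
      fun y _ => one_sub_cos_div_sq_nonneg y
    rw [← intervalIntegral.integral_interval_sub_left
      (intervalIntegrable_one_sub_cos_div_sq 0 b) (intervalIntegrable_one_sub_cos_div_sq 0 a)] at h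
    rw [hχ, hχ]
    exact mul_le_mul_of_nonneg_left (sub_nonneg.1 h) (by positivity)
  · refine (htop.comp Filter.tendsto_neg_atBot_atTop).neg.congr fun x => ?_
    simp [hodd]
end

section
/- Let d ∈ A satisfy ‖d − p‖ < 1/4, and define Θ(d) = (1/(2πi)) ∮_γ (ξ·1 − d)⁻¹ dξ, where γ is the circle {ξ ∈ ℂ : |ξ − 1| = 1/2} traversed counterclockwise (the integrand is defined and norm-continuous on γ since ξ·1 − d is invertible there). Then ‖Θ(d) − p‖ < 1. (In particular, the analogous integral for p itself satisfies (1/(2πi)) ∮_γ (ξ·1 − p)⁻¹ dξ = p, since (ξ·1 − p)⁻¹ = (1−p)/ξ + p/(ξ−1).) -/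
open MeasureTheory

open Metric in
theorem sphere_one_half_bounds {ξ : ℂ} (hξ : ξ ∈ sphere (1 : ℂ) (1 / 2)) :
    ‖ξ⁻¹‖ ≤ 2 ∧ ‖(ξ - 1)⁻¹‖ ≤ 2 ∧ ξ ≠ 0 ∧ ξ - 1 ≠ 0 := by
  rw [mem_sphere_iff_norm] at hξ
  have h : 1 / 2 ≤ ‖ξ‖ := by
    have := norm_sub_le ξ (ξ - 1)
    rw [sub_sub_cancel, norm_one] at this
    linarith
  refine ⟨?_, ?_, ?_, ?_⟩
  · rw [norm_inv]
    exact inv_le_of_inv_le₀ (by norm_num) (by linarith)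
  · rw [norm_inv, hξ]
    norm_num
  · rw [← norm_pos_iff]
    linarith
  · rw [← norm_pos_iff, hξ]
    norm_num

namespace IsStarProjection

theorem norm_central_combination_pow_le {A : Type*} [NormedRing A] [StarRing A] [CStarRing A]
    {p : A} (hp : IsStarProjection p) (k : ℕ) {a b : A}
    (ha : a ∈ Set.center A) (hb : b ∈ Set.center A) :
    ‖a * (1 - p) + b * p‖ ^ 2 ^ k ≤ ‖a‖ ^ 2 ^ k + ‖b‖ ^ 2 ^ k := by
  induction k generalizing a b with
  | zero =>
    simp only [pow_zero, pow_one]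
    calc ‖a * (1 - p) + b * p‖ ≤ ‖a‖ * ‖1 - p‖ + ‖b‖ * ‖p‖ :=
          (norm_add_le _ _).trans (add_le_add (norm_mul_le _ _) (norm_mul_le _ _))
      _ ≤ ‖a‖ + ‖b‖ :=
          add_le_add (mul_le_of_le_one_right (norm_nonneg _) (hp.one_sub.norm_le _))
            (mul_le_of_le_one_right (norm_nonneg _) (hp.norm_le _))
  | succ k ih =>
    have hsa := Set.star_mem_center ha
    have hsb := Set.star_mem_center hb
    have key : star (a * (1 - p) + b * p) * (a * (1 - p) + b * p) =
        (star a * a) * (1 - p) + (star b * b) * p := by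
      have hq := hp.one_sub
      have h1 : (1 - p) * (star a * (a * (1 - p))) = star a * a * (1 - p) := by
        rw [← mul_assoc (star a), ← mul_assoc, ← (Set.mul_mem_center hsa ha).comm (1 - p),
          mul_assoc, hq.isIdempotentElem.eq]
      have h2 : p * (star b * (b * p)) = star b * b * p := by
        rw [← mul_assoc (star b), ← mul_assoc, ← (Set.mul_mem_center hsb hb).comm p,
          mul_assoc, hp.isIdempotentElem.eq]
      have h3 : (1 - p) * (star a * (b * p)) = 0 := by
        rw [← mul_assoc (star a), ← mul_assoc, ← (Set.mul_mem_center hsa hb).comm (1 - p),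
          mul_assoc, hp.one_sub_mul_self, mul_zero]
      have h4 : p * (star b * (a * (1 - p))) = 0 := by
        rw [← mul_assoc (star b), ← mul_assoc, ← (Set.mul_mem_center hsb ha).comm p,
          mul_assoc, hp.mul_one_sub_self, mul_zero]
      rw [star_add, star_mul, star_mul, hq.isSelfAdjoint.star_eq, hp.isSelfAdjoint.star_eq,
        add_mul, mul_add, mul_add, mul_assoc, mul_assoc, mul_assoc, mul_assoc, h1, h2, h3, h4,
        add_zero, zero_add]
    have h := ih (Set.mul_mem_center hsa ha) (Set.mul_mem_center hsb hb)
    rw [← key] at h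
    simpa only [CStarRing.norm_star_mul_self, ← sq, ← pow_mul, ← pow_succ'] using h

/-- The scalars need not interact with the involution. -/
theorem norm_smul_one_sub_add_smul_le {𝕜 A : Type*} [NormedField 𝕜] [NormedRing A] [StarRing A]
    [CStarRing A] [NormedAlgebra 𝕜 A] [NormOneClass A] {p : A} (hp : IsStarProjection p)
    {a b : 𝕜} {m : ℝ} (hm : 0 < m) (ha : ‖a‖ ≤ m) (hb : ‖b‖ ≤ m) :
    ‖a • (1 - p) + b • p‖ ≤ m := by
  by_contra! h
  obtain ⟨n, hn⟩ := pow_unbounded_of_one_lt 2 ((one_lt_div hm).2 h)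
  have hle := hp.norm_central_combination_pow_le n
    (Semigroup.mem_center_iff.2 fun g ↦ (Algebra.commutes a g).symm)
    (Semigroup.mem_center_iff.2 fun g ↦ (Algebra.commutes b g).symm)
  simp only [← Algebra.smul_def, norm_algebraMap'] at hle
  have h1 : ‖a • (1 - p) + b • p‖ ^ 2 ^ n ≤ 2 * m ^ 2 ^ n := by
    have h2 := pow_le_pow_left₀ (norm_nonneg a) ha (2 ^ n)
    have h3 := pow_le_pow_left₀ (norm_nonneg b) hb (2 ^ n)
    linarith
  have h4 := pow_le_pow_right₀ ((one_lt_div hm).2 h).le (Nat.lt_two_pow_self (n := n)).le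
  have h5 : (‖a • (1 - p) + b • p‖ / m) ^ 2 ^ n ≤ 2 := by
    rw [div_pow]
    exact (div_le_iff₀ (by positivity)).2 h1
  linarith

end IsStarProjection

theorem IsIdempotentElem.isUnit_and_inverse_smul_one_sub {𝕜 A : Type*} [Field 𝕜] [Ring A]
    [Algebra 𝕜 A] {p : A} (hp : IsIdempotentElem p) {ξ : 𝕜} (h0 : ξ ≠ 0) (h1 : ξ - 1 ≠ 0) :
    IsUnit (ξ • (1 : A) - p) ∧
      Ring.inverse (ξ • (1 : A) - p) = ξ⁻¹ • (1 - p) + (ξ - 1)⁻¹ • p := by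
  have hdecomp : ξ • (1 : A) - p = ξ • (1 - p) + (ξ - 1) • p := by
    rw [smul_sub, sub_smul, one_smul]
    abel
  have hl : (ξ • (1 : A) - p) * (ξ⁻¹ • (1 - p) + (ξ - 1)⁻¹ • p) = 1 := by
    simp [hdecomp, add_mul, mul_add, smul_smul, hp.eq, hp.one_sub.eq, hp.mul_one_sub_self,
      hp.one_sub_mul_self, h0, h1, -smul_add]
  have hr : (ξ⁻¹ • (1 - p) + (ξ - 1)⁻¹ • p) * (ξ • (1 : A) - p) = 1 := by
    simp [hdecomp, add_mul, mul_add, smul_smul, hp.eq, hp.one_sub.eq, hp.mul_one_sub_self,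
      hp.one_sub_mul_self, h0, h1, -smul_add]
  let u : Aˣ := ⟨_, _, hl, hr⟩
  exact ⟨u.isUnit, Ring.inverse_unit u⟩

theorem isUnit_sub_and_norm_inverse_sub_le {A : Type*} [NormedRing A] [CompleteSpace A]
    {x e : A} (hx : IsUnit x) {M δ : ℝ} (hM : ‖Ring.inverse x‖ ≤ M) (hδ : ‖e‖ ≤ δ)
    (hMδ : M * δ < 1) :
    IsUnit (x - e) ∧
      ‖Ring.inverse (x - e) - Ring.inverse x‖ ≤ M * δ * (M / (1 - M * δ)) := by
  set u := Ring.inverse x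
  have hM0 : 0 ≤ M := (norm_nonneg _).trans hM
  have hue : ‖u * e‖ ≤ M * δ :=
    (norm_mul_le _ _).trans (mul_le_mul hM hδ (norm_nonneg _) hM0)
  have hfac : x - e = x * (1 - u * e) := by
    rw [mul_sub, mul_one, ← mul_assoc, Ring.mul_inverse_cancel x hx, one_mul]
  have hunit : IsUnit (x - e) := by
    rw [hfac]
    exact hx.mul (isUnit_one_sub_of_norm_lt_one (hue.trans_lt hMδ))
  set r := Ring.inverse (x - e)
  have hdiff : r - u = u * e * r := by
    have h : u * ((x - e) * r) = u := by
      rw [Ring.mul_inverse_cancel _ hunit, mul_one]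
    rw [sub_mul, mul_sub, ← mul_assoc u x, Ring.inverse_mul_cancel x hx, one_mul,
      ← mul_assoc] at h
    rw [sub_eq_iff_eq_add, ← sub_eq_iff_eq_add', h]
  have hmul : ‖r - u‖ ≤ M * δ * ‖r‖ := by
    rw [hdiff]
    exact (norm_mul_le _ _).trans (mul_le_mul_of_nonneg_right hue (norm_nonneg _))
  have hr : ‖r‖ ≤ M / (1 - M * δ) := by
    rw [le_div_iff₀ (by linarith)]
    have := norm_le_norm_add_norm_sub' r u
    linarith
  exact ⟨hunit, hmul.trans (mul_le_mul_of_nonneg_left hr ((norm_nonneg _).trans hue))⟩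

theorem circleIntegrable_inverse_smul_one_sub {A : Type*} [NormedRing A] [NormedAlgebra ℂ A]
    [CompleteSpace A] {d : A} {c : ℂ} {R : ℝ} (hR : 0 ≤ R)
    (h : ∀ ξ ∈ Metric.sphere c R, IsUnit (ξ • (1 : A) - d)) :
    CircleIntegrable (fun ξ ↦ Ring.inverse (ξ • (1 : A) - d)) c R := by
  refine ContinuousOn.circleIntegrable hR fun ξ hξ ↦ ContinuousAt.continuousWithinAt ?_
  obtain ⟨u, hu⟩ := h ξ hξ
  have hinv := NormedRing.inverse_continuousAt u
  rw [hu] at hinv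
  exact ContinuousAt.comp (f := fun ξ : ℂ ↦ ξ • (1 : A) - d) hinv (by fun_prop)

open Metric in
theorem IsIdempotentElem.circleIntegral_inverse {A : Type*} [NormedRing A] [NormedAlgebra ℂ A]
    [CompleteSpace A] {p : A} (hp : IsIdempotentElem p) :
    (2 * (Real.pi : ℂ) * Complex.I)⁻¹ •
      (∮ ξ in C(1, 1 / 2), Ring.inverse (ξ • (1 : A) - p)) = p := by
  have hhalf : (0 : ℝ) ≤ 1 / 2 := by norm_num
  have hne : ∀ ξ ∈ closedBall (1 : ℂ) (1 / 2), ξ ≠ 0 := by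
    rintro ξ hξ rfl
    norm_num [mem_closedBall, dist_eq_norm] at hξ
  have hcont : ContinuousOn (fun ξ : ℂ ↦ ξ⁻¹) (closedBall 1 (1 / 2)) :=
    continuousOn_id.inv₀ hne
  have hzero : (∮ ξ in C(1, 1 / 2), ξ⁻¹) = 0 :=
    Complex.circleIntegral_eq_zero_of_differentiable_on_off_countable hhalf Set.countable_empty
      hcont fun ξ hξ ↦ differentiableAt_inv (hne ξ (ball_subset_closedBall hξ.1))
  have hint₀ : CircleIntegrable (fun ξ : ℂ ↦ ξ⁻¹ • (1 - p)) 1 (1 / 2) :=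
    ((hcont.mono sphere_subset_closedBall).smul continuousOn_const).circleIntegrable hhalf
  have hint₁ : CircleIntegrable (fun ξ : ℂ ↦ (ξ - 1)⁻¹ • p) 1 (1 / 2) :=
    (((continuousOn_id.sub continuousOn_const).inv₀
      fun ξ hξ ↦ (sphere_one_half_bounds hξ).2.2.2).smul continuousOn_const).circleIntegrable hhalf
  rw [circleIntegral.integral_congr hhalf fun ξ hξ ↦
      (hp.isUnit_and_inverse_smul_one_sub (sphere_one_half_bounds hξ).2.2.1
        (sphere_one_half_bounds hξ).2.2.2).2,
    circleIntegral.integral_add hint₀ hint₁, circleIntegral.integral_smul_const,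
    circleIntegral.integral_smul_const, hzero,
    circleIntegral.integral_sub_center_inv _ (by norm_num), zero_smul, zero_add,
    inv_smul_smul₀ Complex.two_pi_I_ne_zero]

/-- **The holomorphic functional calculus idempotent is close to `p`.**
Let `A` be a unital C*-algebra, `p ∈ A` a projection and `d ∈ A` with
`‖d - p‖ < 1/4`. Define `Θ(d) = (1/(2πi)) ∮_{|ξ-1|=1/2} (ξ·1 - d)⁻¹ dξ`
(counterclockwise circle integral; the resolvent is given by `Ring.inverse`,
which agrees with the genuine inverse since `ξ·1 - d` is invertible on the
circle). Then `‖Θ(d) - p‖ < 1`. Moreover, the analogous integral for `p`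
itself recovers `p`: `(1/(2πi)) ∮_{|ξ-1|=1/2} (ξ·1 - p)⁻¹ dξ = p`. -/
theorem riesz_idempotent_close_to_projection
    {A : Type*} [NormedRing A] [StarRing A] [CStarRing A]
    [NormedAlgebra ℂ A] [CompleteSpace A] [NormOneClass A]
    (p : A) (hp_idem : p * p = p) (hp_star : star p = p)
    (d : A) (hd : ‖d - p‖ < 1 / 4)
    (Θd : A)
    (hΘ : Θd = (2 * (Real.pi : ℂ) * Complex.I)⁻¹ •
      ∮ ξ in C(1, 1 / 2), Ring.inverse (ξ • (1 : A) - d)) :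
    ‖Θd - p‖ < 1 ∧
    (2 * (Real.pi : ℂ) * Complex.I)⁻¹ •
      (∮ ξ in C(1, 1 / 2), Ring.inverse (ξ • (1 : A) - p)) = p := by
  have hp : IsStarProjection p := ⟨hp_idem, hp_star⟩
  have hΘp := hp.isIdempotentElem.circleIntegral_inverse
  refine ⟨?_, hΘp⟩
  have hhalf : (0 : ℝ) ≤ 1 / 2 := by norm_num
  have hunit : ∀ ξ ∈ Metric.sphere (1 : ℂ) (1 / 2), IsUnit (ξ • (1 : A) - p) := fun ξ hξ ↦
    (hp.isIdempotentElem.isUnit_and_inverse_smul_one_sub (sphere_one_half_bounds hξ).2.2.1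
      (sphere_one_half_bounds hξ).2.2.2).1
  have hres : ∀ ξ ∈ Metric.sphere (1 : ℂ) (1 / 2), IsUnit (ξ • (1 : A) - d) ∧
      ‖Ring.inverse (ξ • (1 : A) - d) - Ring.inverse (ξ • (1 : A) - p)‖ ≤
        2 * ‖d - p‖ * (2 / (1 - 2 * ‖d - p‖)) := by
    intro ξ hξ
    obtain ⟨h0, h1, hξ0, hξ1⟩ := sphere_one_half_bounds hξ
    have hM : ‖Ring.inverse (ξ • (1 : A) - p)‖ ≤ 2 := by
      rw [(hp.isIdempotentElem.isUnit_and_inverse_smul_one_sub hξ0 hξ1).2]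
      exact hp.norm_smul_one_sub_add_smul_le two_pos h0 h1
    have h := isUnit_sub_and_norm_inverse_sub_le (hunit ξ hξ) hM (le_refl ‖d - p‖)
      (by linarith)
    rwa [sub_sub_sub_cancel_right] at h
  have hdiff : Θd - p = (2 * (Real.pi : ℂ) * Complex.I)⁻¹ • ∮ ξ in C(1, 1 / 2),
      (Ring.inverse (ξ • (1 : A) - d) - Ring.inverse (ξ • (1 : A) - p)) := by
    rw [circleIntegral.integral_sub
        (circleIntegrable_inverse_smul_one_sub hhalf fun ξ hξ ↦ (hres ξ hξ).1)
        (circleIntegrable_inverse_smul_one_sub hhalf hunit), smul_sub, ← hΘ, hΘp]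
  rw [hdiff]
  refine (circleIntegral.norm_two_pi_i_inv_smul_integral_le_of_norm_le_const hhalf
    fun ξ hξ ↦ (hres ξ hξ).2).trans_lt ?_
  have hpos : 0 < 1 - 2 * ‖d - p‖ := by linarith
  rw [← mul_assoc, ← mul_div_assoc, div_lt_one hpos]
  linarith
end
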